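/- arXiv:2106.06741 — 5 statements merged into one kernel-verified Lean document; each statement's English description precedes it below -/
import Mathlib

section
/- For every θ' ∈ Θ and every θ ∈ cl Θ, one has D_c(θ'‖θ) = 0 if and only if θ' = θ. -/
open scoped Classical

noncomputable section

def Theta (d : ℕ) : Set (Matrix (Fin d) (Fin d) ℝ) :=
  {θ | (∀ i j, 0 < θ i j) ∧ (∑ i, ∑ j, θ i j) = 1 ∧ ∀ i, (∑ j, θ i j) = ∑ j, θ j i}

def ThetaP (d : ℕ) : Set (Matrix (Fin d) (Fin d) ℝ) :=
  {θ | (∀ i j, 0 ≤ θ i j) ∧ (∑ i, ∑ j, θ i j) = 1}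

/-- Conditional relative entropy, with the conventions `0·log(0/q) = 0` and `p·log(p/0) = ∞`. -/
def condRelEnt {d : ℕ} (θ' θ : Matrix (Fin d) (Fin d) ℝ) : EReal :=
  ∑ i, ∑ j,
    if θ' i j = 0 then (0 : EReal)
    else if θ i j = 0 then (⊤ : EReal)
    else ((θ' i j * (Real.log (θ' i j / ∑ k, θ' i k) - Real.log (θ i j / ∑ k, θ i k)) : ℝ) : EReal)

/-- Real-valued conditional relative entropy (valid whenever `θ` has positive entries,
so that no `∞` can occur; the convention `0·log(0/q) = 0` is automatic). -/
def condRelEntR {d : ℕ} (θ' θ : Matrix (Fin d) (Fin d) ℝ) : ℝ :=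
  ∑ i, ∑ j, θ' i j * (Real.log (θ' i j / ∑ k, θ' i k) - Real.log (θ i j / ∑ k, θ i k))

theorem EReal.finset_sum_ne_bot {ι : Type*} {s : Finset ι} {f : ι → EReal}
    (h : ∀ i ∈ s, f i ≠ ⊥) : ∑ i ∈ s, f i ≠ ⊥ :=
  Finset.sum_induction f (· ≠ ⊥) (fun _ _ ha hb => by simp [EReal.add_eq_bot_iff, ha, hb])
    (by simp) h

theorem EReal.finset_sum_eq_top {ι : Type*} {s : Finset ι} {f : ι → EReal}
    (h : ∀ i ∈ s, f i ≠ ⊥) {i : ι} (hi : i ∈ s) (hf : f i = ⊤) : ∑ i ∈ s, f i = ⊤ := by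
  rw [← Finset.add_sum_erase s f hi, hf]
  exact EReal.top_add_of_ne_bot
    (EReal.finset_sum_ne_bot fun j hj => h j (Finset.mem_of_mem_erase hj))

theorem EReal.coe_finset_sum_real {ι : Type*} (s : Finset ι) (f : ι → ℝ) :
    ((∑ i ∈ s, f i : ℝ) : EReal) = ∑ i ∈ s, (f i : EReal) := by
  induction s using Finset.induction_on with
  | empty => simp
  | insert a s ha ih => rw [Finset.sum_insert ha, Finset.sum_insert ha, EReal.coe_add, ih]

/-- Matrices in the closure of `Theta d` are nonnegative, normalized and balanced. -/
theorem closure_Theta_subset (d : ℕ) : closure (Theta d) ⊆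
    {θ | (∀ i j, 0 ≤ θ i j) ∧ (∑ i, ∑ j, θ i j) = 1 ∧ ∀ i, (∑ j, θ i j) = ∑ j, θ j i} := by
  refine closure_minimal (fun θ h => ⟨fun i j => (h.1 i j).le, h.2⟩) ?_
  simp only [Set.ofPred_and, Set.ofPred_forall]
  refine IsClosed.inter ?_ (IsClosed.inter ?_ ?_)
  · exact isClosed_iInter fun i => isClosed_iInter fun j =>
      isClosed_le continuous_const (by fun_prop)
  · exact isClosed_eq (by fun_prop) continuous_const
  · exact isClosed_iInter fun i => isClosed_eq (by fun_prop) (by fun_prop)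

theorem condRelEnt_eq_coe {d : ℕ} {θ' θ : Matrix (Fin d) (Fin d) ℝ}
    (hθ' : ∀ i j, 0 < θ' i j) (hθ : ∀ i j, 0 < θ i j) :
    condRelEnt θ' θ = (condRelEntR θ' θ : EReal) := by
  simp [condRelEnt, condRelEntR, EReal.coe_finset_sum_real, (hθ' _ _).ne', (hθ _ _).ne']

theorem condRelEnt_eq_top {d : ℕ} {θ' θ : Matrix (Fin d) (Fin d) ℝ}
    {i j : Fin d} (hθ' : θ' i j ≠ 0) (hθ : θ i j = 0) : condRelEnt θ' θ = ⊤ := by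
  have hne : ∀ a b, (if θ' a b = 0 then (0 : EReal) else if θ a b = 0 then (⊤ : EReal)
      else ((θ' a b * (Real.log (θ' a b / ∑ k, θ' a k) - Real.log (θ a b / ∑ k, θ a k)) : ℝ) :
        EReal)) ≠ ⊥ := by
    intro a b
    split_ifs
    · simp
    · simp
    · exact EReal.coe_ne_bot _
  refine EReal.finset_sum_eq_top (fun a _ => EReal.finset_sum_ne_bot fun b _ => hne a b)
    (Finset.mem_univ i) ?_
  refine EReal.finset_sum_eq_top (fun b _ => hne i b) (Finset.mem_univ j) ?_
  simp [hθ', hθ]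

/-- Termwise Gibbs inequality, in a form whose right-hand sides sum to zero over a row. -/
theorem sub_le_mul_log_div_sub {x s y t : ℝ} (hx : 0 < x) (hs : 0 < s) (hy : 0 < y)
    (ht : 0 < t) : x - s * (y / t) ≤ x * (Real.log (x / s) - Real.log (y / t)) := by
  have hlog : Real.log (y / t / (x / s)) = Real.log (y / t) - Real.log (x / s) :=
    Real.log_div (by positivity) (by positivity)
  have h := mul_le_mul_of_nonneg_left
    (Real.log_le_sub_one_of_pos (show 0 < y / t / (x / s) by positivity)) hx.le
  have e : x * (y / t / (x / s) - 1) = s * (y / t) - x := by field_simp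
  rw [e, hlog] at h
  linarith

theorem div_eq_div_of_mul_log_div_sub_eq {x s y t : ℝ} (hx : 0 < x) (hs : 0 < s) (hy : 0 < y)
    (ht : 0 < t) (h : x - s * (y / t) = x * (Real.log (x / s) - Real.log (y / t))) :
    y / t = x / s := by
  by_contra hne
  have hlog : Real.log (y / t / (x / s)) = Real.log (y / t) - Real.log (x / s) :=
    Real.log_div (by positivity) (by positivity)
  have hlt := mul_lt_mul_of_pos_left
    (Real.log_lt_sub_one_of_pos (show 0 < y / t / (x / s) by positivity)
      (fun h1 => hne ((div_eq_one_iff_eq (by positivity)).1 h1))) hx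
  have e : x * (y / t / (x / s) - 1) = s * (y / t) - x := by field_simp
  rw [e, hlog] at hlt
  linarith

/-- Vanishing conditional relative entropy forces equal transition probabilities. -/
theorem div_row_sum_eq_of_condRelEntR_eq_zero {d : ℕ} {θ' θ : Matrix (Fin d) (Fin d) ℝ}
    (hθ' : ∀ i j, 0 < θ' i j) (hθ : ∀ i j, 0 < θ i j) (h : condRelEntR θ' θ = 0) (i j : Fin d) :
    θ i j / ∑ k, θ i k = θ' i j / ∑ k, θ' i k := by
  have hs' : ∀ i, 0 < ∑ k, θ' i k := fun i => Finset.sum_pos (fun k _ => hθ' i k) ⟨i, by simp⟩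
  have hs : ∀ i, 0 < ∑ k, θ i k := fun i => Finset.sum_pos (fun k _ => hθ i k) ⟨i, by simp⟩
  have hle := fun i j => sub_le_mul_log_div_sub (hθ' i j) (hs' i) (hθ i j) (hs i)
  have hrow : ∀ i, ∑ j, (θ' i j - (∑ k, θ' i k) * (θ i j / ∑ k, θ i k)) = 0 := fun i => by
    rw [Finset.sum_sub_distrib, ← Finset.mul_sum, ← Finset.sum_div, div_self (hs i).ne', mul_one,
      sub_self]
  have htot : ∑ i, ∑ j, (θ' i j - (∑ k, θ' i k) * (θ i j / ∑ k, θ i k)) =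
      ∑ i, ∑ j, θ' i j * (Real.log (θ' i j / ∑ k, θ' i k) - Real.log (θ i j / ∑ k, θ i k)) := by
    rw [Finset.sum_eq_zero fun i _ => hrow i]
    exact h.symm
  have hi := (Finset.sum_eq_sum_iff_of_le
    fun i _ => Finset.sum_le_sum fun j _ => hle i j).1 htot i (Finset.mem_univ i)
  have hij := (Finset.sum_eq_sum_iff_of_le fun j _ => hle i j).1 hi j (Finset.mem_univ j)
  exact div_eq_div_of_mul_log_div_sub_eq (hθ' i j) (hs' i) (hθ i j) (hs i) hij

/-- A positive balanced matrix rescaled row by row stays balanced only if all scalings agree. -/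
theorem row_scaling_eq_of_balanced {d : ℕ} {θ : Matrix (Fin d) (Fin d) ℝ} {r : Fin d → ℝ}
    (hθ : ∀ i j, 0 < θ i j) (hb : ∀ i, (∑ j, θ i j) = ∑ j, θ j i)
    (hr : ∀ i, (∑ j, r i * θ i j) = ∑ j, r j * θ j i) (a b : Fin d) : r a = r b := by
  obtain ⟨m, -, hm⟩ := Finset.exists_max_image Finset.univ r ⟨a, Finset.mem_univ a⟩
  have h0 : ∑ i, (r m - r i) * θ i m = 0 := by
    simp only [sub_mul, Finset.sum_sub_distrib]
    rw [← hr m, ← Finset.mul_sum, ← Finset.mul_sum, hb m, sub_self]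
  have hmax : ∀ i, r i = r m := fun i => by
    have h1 := (Finset.sum_eq_zero_iff_of_nonneg fun i hi =>
      mul_nonneg (sub_nonneg.2 (hm i hi)) (hθ i m).le).1 h0 i (Finset.mem_univ i)
    have h2 := (mul_eq_zero.1 h1).resolve_right (hθ i m).ne'
    linarith
  rw [hmax a, hmax b]

theorem stmt_1 (d : ℕ) (hd : 1 ≤ d) (θ' θ : Matrix (Fin d) (Fin d) ℝ)
    (hθ' : θ' ∈ Theta d) (hθ : θ ∈ closure (Theta d)) :
    condRelEnt θ' θ = 0 ↔ θ' = θ := by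
  obtain ⟨hpos', hsum', hbal'⟩ := hθ'
  obtain ⟨hnonneg, hsum, hbal⟩ := closure_Theta_subset d hθ
  constructor
  · intro h
    have hpos : ∀ i j, 0 < θ i j := fun i j => (hnonneg i j).lt_of_ne' fun h0 => by
      rw [condRelEnt_eq_top (hpos' i j).ne' h0] at h
      exact EReal.top_ne_zero h
    rw [condRelEnt_eq_coe hpos' hpos, EReal.coe_eq_zero] at h
    have hdiv := div_row_sum_eq_of_condRelEntR_eq_zero hpos' hpos h
    have hs : ∀ i, 0 < ∑ k, θ i k := fun i => Finset.sum_pos (fun k _ => hpos i k) ⟨i, by simp⟩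
    set r : Fin d → ℝ := fun i => (∑ k, θ i k) / ∑ k, θ' i k with hrdef
    have hscale : ∀ i j, θ i j = r i * θ' i j := fun i j => by
      rw [(div_eq_iff (hs i).ne').1 (hdiv i j), hrdef]
      ring
    have hr := row_scaling_eq_of_balanced hpos' hbal' (r := r) (by simpa only [hscale] using hbal)
    ext i j
    have hri : r i = 1 := by
      have : ∑ a, ∑ b, θ a b = r i * ∑ a, ∑ b, θ' a b := by
        simp only [Finset.mul_sum]
        exact Finset.sum_congr rfl fun a _ => Finset.sum_congr rfl fun b _ => by
          rw [hscale a b, hr a i]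
      rw [hsum, hsum', mul_one] at this
      exact this.symm
    rw [hscale i j, hri, one_mul]
  · rintro rfl
    rw [condRelEnt_eq_coe hpos' hpos', EReal.coe_eq_zero]
    simp [condRelEntR]
end
end

section
/- The map (θ',θ) ↦ D_c(θ'‖θ) is jointly continuous on Θ' × Θ. -/
open scoped Classical

noncomputable section

/-- On nonnegative matrices, the logarithms of quotients split into `x log x` terms. -/
lemma condRelEntR_eq_of_nonneg_of_pos {d : ℕ} {θ' θ : Matrix (Fin d) (Fin d) ℝ}
    (hθ' : ∀ i j, 0 ≤ θ' i j) (hθ : ∀ i j, 0 < θ i j) :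
    condRelEntR θ' θ =
      ∑ i, ((∑ j, θ' i j * Real.log (θ' i j)) - (∑ k, θ' i k) * Real.log (∑ k, θ' i k)
        - ∑ j, θ' i j * (Real.log (θ i j) - Real.log (∑ k, θ i k))) := by
  refine Finset.sum_congr rfl fun i _ => ?_
  rw [Finset.sum_mul, ← Finset.sum_sub_distrib, ← Finset.sum_sub_distrib]
  refine Finset.sum_congr rfl fun j _ => ?_
  rcases (hθ' i j).eq_or_lt with h | h
  · simp [← h]
  · have hrow' : 0 < ∑ k, θ' i k :=
      Finset.sum_pos' (fun k _ => hθ' i k) ⟨j, Finset.mem_univ j, h⟩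
    have hrow : 0 < ∑ k, θ i k :=
      Finset.sum_pos (fun k _ => hθ i k) ⟨j, Finset.mem_univ j⟩
    rw [Real.log_div h.ne' hrow'.ne', Real.log_div (hθ i j).ne' hrow.ne']
    ring

theorem stmt_3 (d : ℕ) (hd : 1 ≤ d) :
    ContinuousOn
      (fun p : Matrix (Fin d) (Fin d) ℝ × Matrix (Fin d) (Fin d) ℝ => condRelEntR p.1 p.2)
      (ThetaP d ×ˢ Theta d) := by
  have hentry : ∀ i j : Fin d, Continuous fun M : Matrix (Fin d) (Fin d) ℝ => M i j :=
    fun i j => continuous_id.matrix_elem i j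
  have hrow : ∀ i : Fin d, Continuous fun M : Matrix (Fin d) (Fin d) ℝ => ∑ k, M i k :=
    fun i => continuous_finsetSum _ fun k _ => hentry i k
  refine ContinuousOn.congr ?_ fun p hp => condRelEntR_eq_of_nonneg_of_pos hp.1.1 hp.2.1
  refine continuousOn_finsetSum _ fun i _ => ContinuousOn.sub (ContinuousOn.sub ?_ ?_) ?_
  · exact (continuous_finsetSum _ fun j _ =>
      Real.continuous_mul_log.comp ((hentry i j).comp continuous_fst)).continuousOn
  · exact (Real.continuous_mul_log.comp ((hrow i).comp continuous_fst)).continuousOn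
  · refine continuousOn_finsetSum _ fun j _ =>
      ((hentry i j).comp continuous_fst).continuousOn.mul (ContinuousOn.sub ?_ ?_)
    · exact ((hentry i j).comp continuous_snd).continuousOn.log fun p hp => (hp.2.1 i j).ne'
    · exact ((hrow i).comp continuous_snd).continuousOn.log fun p hp =>
        (Finset.sum_pos (fun k _ => hp.2.1 i k) ⟨j, Finset.mem_univ j⟩).ne'
end
end

section
/- Let d = 2, let θ' be the 2×2 matrix with entries θ'_{11} = 0.2, θ'_{12} = θ'_{21} = 0.375, θ'_{22} = 0.05, and define f(θ) = Σ_{i,j=1}^2 θ'_{ij}·(−log(θ_{ij}/Σ_{k=1}^2 θ_{ik})) for θ ∈ Θ. Let θ₁ be the matrix with entries (0.9, 0.045; 0.045, 0.01) and θ₂ the matrix with entries (0.01, 0.045; 0.045, 0.9). Then θ₁, θ₂ ∈ Θ, f(θ₁) ≤ 1.6, f(θ₂) ≤ 1.6, and f((θ₁+θ₂)/2) > 1.6; consequently the sublevel set {θ ∈ Θ : f(θ) ≤ 1.6} is not convex. -/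
open scoped Classical

noncomputable section

/-- If `x ^ n ≤ 2 ^ m`, then `n * log x ≤ m * log 2`. -/
lemma nat_mul_log_le_of_pow_le_two_pow {x : ℝ} (hx : 0 < x) {n m : ℕ} (h : x ^ n ≤ 2 ^ m) :
    n * Real.log x ≤ m * Real.log 2 := by
  rw [← Real.log_pow, ← Real.log_pow]
  exact Real.log_le_log (pow_pos hx n) h

/-- If `x ^ n ≥ 2 ^ m`, then `n * log x ≥ m * log 2`. -/
lemma nat_mul_log_ge_of_two_pow_le_pow {x : ℝ} {n m : ℕ} (h : 2 ^ m ≤ x ^ n) :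
    m * Real.log 2 ≤ n * Real.log x := by
  rw [← Real.log_pow, ← Real.log_pow]
  exact Real.log_le_log (by positivity) h

theorem stmt_4 :
    let θ' : Matrix (Fin 2) (Fin 2) ℝ := !![0.2, 0.375; 0.375, 0.05]
    let f : Matrix (Fin 2) (Fin 2) ℝ → ℝ :=
      fun θ => ∑ i, ∑ j, θ' i j * (-Real.log (θ i j / ∑ k, θ i k))
    let θ₁ : Matrix (Fin 2) (Fin 2) ℝ := !![0.9, 0.045; 0.045, 0.01]
    let θ₂ : Matrix (Fin 2) (Fin 2) ℝ := !![0.01, 0.045; 0.045, 0.9]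
    θ₁ ∈ Theta 2 ∧ θ₂ ∈ Theta 2 ∧ f θ₁ ≤ 1.6 ∧ f θ₂ ≤ 1.6 ∧
      1.6 < f ((2 : ℝ)⁻¹ • (θ₁ + θ₂)) ∧
      ¬ Convex ℝ {θ : Matrix (Fin 2) (Fin 2) ℝ | θ ∈ Theta 2 ∧ f θ ≤ 1.6} := by
  intro θ' f θ₁ θ₂
  have log_two_lt := Real.log_two_lt_d9
  have log_two_gt := Real.log_two_gt_d9
  have log_bound_11_2 : 2 * Real.log (11 / 2) ≤ 5 * Real.log 2 :=
    mod_cast nat_mul_log_le_of_pow_le_two_pow (x := 11 / 2) (n := 2) (m := 5)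
      (by norm_num) (by norm_num)
  have log_bound_21 : 5 * Real.log 21 ≤ 22 * Real.log 2 :=
    mod_cast nat_mul_log_le_of_pow_le_two_pow (x := 21) (n := 5) (m := 22)
      (by norm_num) (by norm_num)
  have log_bound_100_9 : 13 * Real.log 2 ≤ 4 * Real.log (100 / 9) :=
    mod_cast nat_mul_log_ge_of_two_pow_le_pow (x := 100 / 9) (n := 4) (m := 13) (by norm_num)
  have log_bound_11_9 := Real.log_le_sub_one_of_pos (show (0 : ℝ) < 11 / 9 by norm_num)
  have log_bound_21_20 := Real.log_le_sub_one_of_pos (show (0 : ℝ) < 21 / 20 by norm_num)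
  have log_nonneg_100_91 := Real.log_nonneg (show (1 : ℝ) ≤ 100 / 91 by norm_num)
  have mem₁ : θ₁ ∈ Theta 2 := by
    refine ⟨fun i j => ?_, ?_, fun i => ?_⟩
    · fin_cases i <;> fin_cases j <;> norm_num [θ₁]
    · norm_num [θ₁, Fin.sum_univ_two]
    · fin_cases i <;> norm_num [θ₁, Fin.sum_univ_two]
  have mem₂ : θ₂ ∈ Theta 2 := by
    refine ⟨fun i j => ?_, ?_, fun i => ?_⟩
    · fin_cases i <;> fin_cases j <;> norm_num [θ₂]
    · norm_num [θ₂, Fin.sum_univ_two]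
    · fin_cases i <;> norm_num [θ₂, Fin.sum_univ_two]
  have le₁ : f θ₁ ≤ 1.6 := by
    simp only [f, θ', θ₁, Fin.sum_univ_two, ← Real.log_inv]
    norm_num
    linarith
  have le₂ : f θ₂ ≤ 1.6 := by
    simp only [f, θ', θ₂, Fin.sum_univ_two, ← Real.log_inv]
    norm_num
    linarith
  have lt_mid : 1.6 < f ((2 : ℝ)⁻¹ • (θ₁ + θ₂)) := by
    simp only [f, θ', θ₁, θ₂, Fin.sum_univ_two, ← Real.log_inv]
    norm_num
    linarith
  refine ⟨mem₁, mem₂, le₁, le₂, lt_mid, fun hconv => ?_⟩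
  have mid_mem := hconv ⟨mem₁, le₁⟩ ⟨mem₂, le₂⟩ (show (0 : ℝ) ≤ 2⁻¹ by norm_num)
    (show (0 : ℝ) ≤ 2⁻¹ by norm_num) (by norm_num)
  rw [← smul_add] at mid_mem
  exact absurd mid_mem.2 (not_le.mpr lt_mid)
end
end

section
/- Let P ∈ ℝ^{d×d} be a row-stochastic matrix with all entries strictly positive. Then the matrix A_d(P) is invertible, and the vector π ∈ ℝ^d defined by π_i = (A_d(P)^{-1})_{id} is the unique vector satisfying π P = π (as a row vector) and Σ_{i=1}^d π_i = 1; moreover π_i > 0 for all i. -/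
open scoped Classical

noncomputable section

/-- The matrix `A_d(P)` from the paper: last row all ones; for `i < d`,
diagonal entry `P_ii − 1` and off-diagonal entry `(A_d(P))_{ij} = P_{ji}`. -/
def Amat (d : ℕ) (P : Matrix (Fin d) (Fin d) ℝ) : Matrix (Fin d) (Fin d) ℝ :=
  Matrix.of fun i j => if (i : ℕ) + 1 = d then (1 : ℝ) else if i = j then P i i - 1 else P j i

/-- The vector `π` with `π_i = (A_d(P)⁻¹)_{id}` (last column of the inverse). -/
def statVec (d : ℕ) (hd : 1 ≤ d) (P : Matrix (Fin d) (Fin d) ℝ) : Fin d → ℝ :=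
  fun i => (Amat d P)⁻¹ i ⟨d - 1, by omega⟩

/-- Right multiplication by a row-stochastic matrix preserves the sum of a vector. -/
theorem sum_mul_stochastic {ι : Type*} [Fintype ι] {P : Matrix ι ι ℝ}
    (hrow : ∀ i, ∑ j, P i j = 1) (v : ι → ℝ) : ∑ j, ∑ i, v i * P i j = ∑ i, v i := by
  rw [Finset.sum_comm]
  simp [← Finset.mul_sum, hrow]

/-- A stationary vector of a positive stochastic matrix with one positive entry is positive. -/
theorem stationary_pos_of_exists_pos {ι : Type*} [Fintype ι] {P : Matrix ι ι ℝ}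
    (hpos : ∀ i j, 0 < P i j) (hrow : ∀ i, ∑ j, P i j = 1) {v : ι → ℝ}
    (hv : ∀ j, ∑ i, v i * P i j = v j) (hex : ∃ i, 0 < v i) (j : ι) : 0 < v j := by
  have hle : ∀ j ∈ Finset.univ, max (v j) 0 ≤ ∑ i, max (v i) 0 * P i j := by
    intro j _
    refine max_le ?_ (Finset.sum_nonneg fun i _ => mul_nonneg (le_max_right _ _) (hpos i j).le)
    rw [← hv j]
    exact Finset.sum_le_sum fun i _ => mul_le_mul_of_nonneg_right (le_max_left _ _) (hpos i j).le
  have heq := (Finset.sum_eq_sum_iff_of_le hle).1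
    (sum_mul_stochastic hrow fun i => max (v i) 0).symm j (Finset.mem_univ j)
  obtain ⟨k, hk⟩ := hex
  have hsum : 0 < ∑ i, max (v i) 0 * P i j :=
    Finset.sum_pos' (fun i _ => mul_nonneg (le_max_right _ _) (hpos i j).le)
      ⟨k, Finset.mem_univ k, mul_pos (lt_max_of_lt_left hk) (hpos k j)⟩
  rw [← heq] at hsum
  simpa using hsum

/-- A stationary vector of a positive stochastic matrix whose entries sum to zero vanishes. -/
theorem stationary_eq_zero_of_sum_eq_zero {ι : Type*} [Fintype ι] {P : Matrix ι ι ℝ}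
    (hpos : ∀ i j, 0 < P i j) (hrow : ∀ i, ∑ j, P i j = 1) {v : ι → ℝ}
    (hv : ∀ j, ∑ i, v i * P i j = v j) (hsum : ∑ i, v i = 0) : v = 0 := by
  by_contra hne
  obtain ⟨k, hk⟩ := Function.ne_iff.1 hne
  have hex := Finset.exists_pos_of_sum_zero_of_exists_nonzero v hsum ⟨k, Finset.mem_univ k, hk⟩
  obtain ⟨i, _, hi⟩ := hex
  have hall := stationary_pos_of_exists_pos hpos hrow hv ⟨i, hi⟩
  exact (Finset.sum_pos (fun i _ => hall i) ⟨k, Finset.mem_univ k⟩).ne' hsum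

theorem Amat_mulVec_apply (d : ℕ) (P : Matrix (Fin d) (Fin d) ℝ) (v : Fin d → ℝ) (i : Fin d) :
    (Amat d P).mulVec v i =
      if (i : ℕ) + 1 = d then ∑ j, v j else ∑ j, v j * P j i - v i := by
  simp only [Matrix.mulVec, dotProduct, Amat, Matrix.of_apply]
  split_ifs with h
  · simp
  · have hterm : ∀ j, (if i = j then P i i - 1 else P j i) * v j =
        v j * P j i - if i = j then v j else 0 := by
      intro j
      split_ifs with hij
      · subst hij
        ring
      · ring
    simp [hterm, Finset.sum_sub_distrib]

/-- The system `A_d(P) v = c e_d` says that `v` is stationary with entries summing to `c`. -/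
theorem Amat_mulVec_eq_single_iff {d : ℕ} (hd : 1 ≤ d) {P : Matrix (Fin d) (Fin d) ℝ}
    (hrow : ∀ i, ∑ j, P i j = 1) (v : Fin d → ℝ) (c : ℝ) :
    (Amat d P).mulVec v = Pi.single ⟨d - 1, by omega⟩ c ↔
      (∀ j, ∑ i, v i * P i j = v j) ∧ ∑ i, v i = c := by
  have hlast : ∀ i : Fin d, (i : ℕ) + 1 = d ↔ i = ⟨d - 1, by omega⟩ := by
    intro i
    rw [Fin.ext_iff]
    dsimp only
    omega
  simp only [funext_iff, Amat_mulVec_apply, hlast, Pi.single_apply]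
  constructor
  · intro h
    have hother : ∀ j, j ≠ ⟨d - 1, by omega⟩ → ∑ i, v i * P i j - v j = 0 := by
      intro j hj
      simpa only [if_neg hj] using h j
    refine ⟨fun j => sub_eq_zero.1 ?_, by simpa using h ⟨d - 1, by omega⟩⟩
    by_cases hj : j = ⟨d - 1, by omega⟩
    · have htotal : ∑ j, (∑ i, v i * P i j - v j) = 0 := by
        rw [Finset.sum_sub_distrib, sum_mul_stochastic hrow, sub_self]
      rwa [Finset.sum_eq_single j (fun k _ hk => hother k (hj ▸ hk)) (by simp)] at htotal
    · exact hother j hj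
  · rintro ⟨hv, hsum⟩ i
    rw [hv i, hsum, sub_self]

theorem stmt_7 (d : ℕ) (hd : 1 ≤ d) (P : Matrix (Fin d) (Fin d) ℝ)
    (hpos : ∀ i j, 0 < P i j) (hrow : ∀ i, ∑ j, P i j = 1) :
    IsUnit (Amat d P) ∧
      (∀ i, 0 < statVec d hd P i) ∧
      (∀ j, ∑ i, statVec d hd P i * P i j = statVec d hd P j) ∧
      (∑ i, statVec d hd P i) = 1 ∧
      ∀ σ : Fin d → ℝ, (∀ j, ∑ i, σ i * P i j = σ j) → (∑ i, σ i) = 1 →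
        σ = statVec d hd P := by
  have hunit : IsUnit (Amat d P) := by
    rw [← Matrix.mulVec_injective_iff_isUnit]
    refine (injective_iff_map_eq_zero (Amat d P).mulVecLin).2 fun v hv => ?_
    obtain ⟨hstat, hsum⟩ := (Amat_mulVec_eq_single_iff hd hrow v 0).1 (by simpa using hv)
    exact stationary_eq_zero_of_sum_eq_zero hpos hrow hstat hsum
  have hdet := (Matrix.isUnit_iff_isUnit_det _).1 hunit
  have hvec : statVec d hd P = (Amat d P)⁻¹.mulVec (Pi.single ⟨d - 1, by omega⟩ 1) := by
    ext i
    simp [statVec]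
  obtain ⟨hstat, hsum⟩ := (Amat_mulVec_eq_single_iff hd hrow (statVec d hd P) 1).1 (by
    rw [hvec, Matrix.mulVec_mulVec, Matrix.mul_nonsing_inv _ hdet, Matrix.one_mulVec])
  refine ⟨hunit, stationary_pos_of_exists_pos hpos hrow hstat ?_, hstat, hsum, ?_⟩
  · by_contra! hneg
    linarith [Finset.sum_nonpos fun i (_ : i ∈ Finset.univ) => hneg i]
  · intro σ hσ hσsum
    rw [hvec, ← (Amat_mulVec_eq_single_iff hd hrow σ 1).2 ⟨hσ, hσsum⟩, Matrix.mulVec_mulVec,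
      Matrix.nonsing_inv_mul _ hdet, Matrix.one_mulVec]
end
end

section
/- Let d = 2 and let L₁, L₂ ∈ ℝ with L₁ ≠ L₂. Define Ψ̃(p,q) = Ψ applied to the row-stochastic matrix ((p, 1−p), (q, 1−q)), i.e., Ψ̃(p,q) = L₁·π₁(p,q) + L₂·π₂(p,q) where (π₁,π₂) is the stationary distribution of that matrix. Then for all p, q ∈ (0,1) the determinant of the Hessian of Ψ̃ at (p,q) equals −(L₁−L₂)²/(1−p+q)⁴ < 0; in particular, Ψ̃ is neither convex nor concave on (0,1)². -/
noncomputable section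

/-- `Ψ̃(p,q) = Ψ` of the row-stochastic matrix `((p, 1−p), (q, 1−q))`, i.e.
`L₁·π₁ + L₂·π₂` where `π = (q/(1−p+q), (1−p)/(1−p+q))` is the stationary distribution. -/
def PsiTilde (L₁ L₂ : ℝ) (z : ℝ × ℝ) : ℝ :=
  (L₁ * z.2 + L₂ * (1 - z.1)) / (1 - z.1 + z.2)

theorem hasDerivAt_PsiTilde_fst (L₁ L₂ : ℝ) {p q : ℝ} (h : 1 - p + q ≠ 0) :
    HasDerivAt (fun a => PsiTilde L₁ L₂ (a, q)) ((L₁ - L₂) * q / (1 - p + q) ^ 2) p := by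
  have hs : HasDerivAt (fun a : ℝ => 1 - a) (-1) p := (hasDerivAt_id p).const_sub 1
  refine (((hs.const_mul L₂).const_add (L₁ * q)).div (hs.add_const q) h).congr_deriv ?_
  congr 1
  ring

theorem hasDerivAt_PsiTilde_snd (L₁ L₂ : ℝ) {p q : ℝ} (h : 1 - p + q ≠ 0) :
    HasDerivAt (fun b => PsiTilde L₁ L₂ (p, b)) ((L₁ - L₂) * (1 - p) / (1 - p + q) ^ 2) q := by
  have hs : HasDerivAt (fun b : ℝ => b) 1 q := hasDerivAt_id q
  refine (((hs.const_mul L₁).add_const (L₂ * (1 - p))).div (hs.const_add (1 - p)) h).congr_deriv ?_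
  congr 1
  ring

theorem deriv_deriv_PsiTilde_fst_fst (L₁ L₂ : ℝ) {p q : ℝ} (h : 1 - p + q ≠ 0) :
    deriv (deriv (fun a => PsiTilde L₁ L₂ (a, q))) p =
      2 * (L₁ - L₂) * q / (1 - p + q) ^ 3 := by
  have hev : ∀ᶠ a in nhds p, 1 - a + q ≠ 0 :=
    ContinuousAt.eventually_ne (g := fun a : ℝ => 1 - a + q) (by fun_prop) h
  have heq : deriv (fun a => PsiTilde L₁ L₂ (a, q)) =ᶠ[nhds p]
      fun a => (L₁ - L₂) * q / (1 - a + q) ^ 2 :=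
    hev.mono fun a ha => (hasDerivAt_PsiTilde_fst L₁ L₂ ha).deriv
  have hs : HasDerivAt (fun a : ℝ => 1 - a + q) (-1) p :=
    ((hasDerivAt_id p).const_sub 1).add_const q
  rw [heq.deriv_eq, ((hasDerivAt_const p ((L₁ - L₂) * q)).fun_div (hs.fun_pow 2)
    (pow_ne_zero 2 h)).deriv]
  field_simp
  ring

theorem deriv_deriv_PsiTilde_snd_snd (L₁ L₂ : ℝ) {p q : ℝ} (h : 1 - p + q ≠ 0) :
    deriv (deriv (fun b => PsiTilde L₁ L₂ (p, b))) q =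
      -(2 * (L₁ - L₂) * (1 - p)) / (1 - p + q) ^ 3 := by
  have hev : ∀ᶠ b in nhds q, 1 - p + b ≠ 0 :=
    ContinuousAt.eventually_ne (g := fun b : ℝ => 1 - p + b) (by fun_prop) h
  have heq : deriv (fun b => PsiTilde L₁ L₂ (p, b)) =ᶠ[nhds q]
      fun b => (L₁ - L₂) * (1 - p) / (1 - p + b) ^ 2 :=
    hev.mono fun b hb => (hasDerivAt_PsiTilde_snd L₁ L₂ hb).deriv
  have hs : HasDerivAt (fun b : ℝ => 1 - p + b) 1 q := (hasDerivAt_id q).const_add (1 - p)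
  rw [heq.deriv_eq, ((hasDerivAt_const q ((L₁ - L₂) * (1 - p))).fun_div (hs.fun_pow 2)
    (pow_ne_zero 2 h)).deriv]
  field_simp
  ring

theorem deriv_deriv_PsiTilde_fst_snd (L₁ L₂ : ℝ) {p q : ℝ} (h : 1 - p + q ≠ 0) :
    deriv (fun a => deriv (fun b => PsiTilde L₁ L₂ (a, b)) q) p =
      (L₁ - L₂) * (1 - p - q) / (1 - p + q) ^ 3 := by
  have hev : ∀ᶠ a in nhds p, 1 - a + q ≠ 0 :=
    ContinuousAt.eventually_ne (g := fun a : ℝ => 1 - a + q) (by fun_prop) h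
  have heq : (fun a => deriv (fun b => PsiTilde L₁ L₂ (a, b)) q) =ᶠ[nhds p]
      fun a => (L₁ - L₂) * (1 - a) / (1 - a + q) ^ 2 :=
    hev.mono fun a ha => (hasDerivAt_PsiTilde_snd L₁ L₂ ha).deriv
  have hs : HasDerivAt (fun a : ℝ => 1 - a) (-1) p := (hasDerivAt_id p).const_sub 1
  rw [heq.deriv_eq, ((hs.const_mul (L₁ - L₂)).fun_div ((hs.add_const q).fun_pow 2)
    (pow_ne_zero 2 h)).deriv]
  field_simp
  ring

theorem deriv_deriv_PsiTilde_snd_fst (L₁ L₂ : ℝ) {p q : ℝ} (h : 1 - p + q ≠ 0) :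
    deriv (fun b => deriv (fun a => PsiTilde L₁ L₂ (a, b)) p) q =
      (L₁ - L₂) * (1 - p - q) / (1 - p + q) ^ 3 := by
  have hev : ∀ᶠ b in nhds q, 1 - p + b ≠ 0 :=
    ContinuousAt.eventually_ne (g := fun b : ℝ => 1 - p + b) (by fun_prop) h
  have heq : (fun b => deriv (fun a => PsiTilde L₁ L₂ (a, b)) p) =ᶠ[nhds q]
      fun b => (L₁ - L₂) * b / (1 - p + b) ^ 2 :=
    hev.mono fun b hb => (hasDerivAt_PsiTilde_fst L₁ L₂ hb).deriv
  have hs : HasDerivAt (fun b : ℝ => b) 1 q := hasDerivAt_id q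
  rw [heq.deriv_eq, ((hs.const_mul (L₁ - L₂)).fun_div ((hs.const_add (1 - p)).fun_pow 2)
    (pow_ne_zero 2 h)).deriv]
  field_simp
  ring

/-- Convexity along the two segments through `(1/2, 1/2)` parallel to the axes forces opposite
signs of `L₁ - L₂`. -/
theorem eq_of_convexOn_PsiTilde {L₁ L₂ : ℝ}
    (h : ConvexOn ℝ (Set.Ioo (0 : ℝ) 1 ×ˢ Set.Ioo (0 : ℝ) 1) (PsiTilde L₁ L₂)) : L₁ = L₂ := by
  have midpoint_le (x y : ℝ × ℝ) (hx : x ∈ Set.Ioo (0 : ℝ) 1 ×ˢ Set.Ioo (0 : ℝ) 1)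
      (hy : y ∈ Set.Ioo (0 : ℝ) 1 ×ˢ Set.Ioo (0 : ℝ) 1) :=
    h.2 hx hy (one_half_pos (α := ℝ)).le one_half_pos.le (add_halves 1)
  have hp := midpoint_le (1 / 4, 1 / 2) (3 / 4, 1 / 2) (by norm_num) (by norm_num)
  have hq := midpoint_le (1 / 2, 1 / 4) (1 / 2, 3 / 4) (by norm_num) (by norm_num)
  norm_num [PsiTilde] at hp hq
  linarith

theorem PsiTilde_neg (L₁ L₂ : ℝ) : PsiTilde (-L₁) (-L₂) = -PsiTilde L₁ L₂ := by
  ext z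
  simp only [PsiTilde, Pi.neg_apply]
  ring

theorem stmt_10 (L₁ L₂ : ℝ) (hL : L₁ ≠ L₂) :
    (∀ p ∈ Set.Ioo (0 : ℝ) 1, ∀ q ∈ Set.Ioo (0 : ℝ) 1,
      (deriv (deriv (fun b => PsiTilde L₁ L₂ (b, q))) p) *
          (deriv (deriv (fun b => PsiTilde L₁ L₂ (p, b))) q) -
        (deriv (fun a => deriv (fun b => PsiTilde L₁ L₂ (a, b)) q) p) *
          (deriv (fun b => deriv (fun a => PsiTilde L₁ L₂ (a, b)) p) q) =
        -(L₁ - L₂) ^ 2 / (1 - p + q) ^ 4 ∧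
      -(L₁ - L₂) ^ 2 / (1 - p + q) ^ 4 < 0) ∧
    ¬ ConvexOn ℝ (Set.Ioo (0 : ℝ) 1 ×ˢ Set.Ioo (0 : ℝ) 1) (PsiTilde L₁ L₂) ∧
    ¬ ConcaveOn ℝ (Set.Ioo (0 : ℝ) 1 ×ˢ Set.Ioo (0 : ℝ) 1) (PsiTilde L₁ L₂) := by
  refine ⟨fun p hp q hq => ?_, fun h => hL (eq_of_convexOn_PsiTilde h), fun h => hL ?_⟩
  · have hs : 0 < 1 - p + q := by linarith [hp.2, hq.1]
    refine ⟨?_, div_neg_of_neg_of_pos (neg_neg_of_pos (sq_pos_of_ne_zero (sub_ne_zero.2 hL)))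
      (pow_pos hs 4)⟩
    rw [deriv_deriv_PsiTilde_fst_fst L₁ L₂ hs.ne', deriv_deriv_PsiTilde_snd_snd L₁ L₂ hs.ne',
      deriv_deriv_PsiTilde_fst_snd L₁ L₂ hs.ne', deriv_deriv_PsiTilde_snd_fst L₁ L₂ hs.ne']
    field_simp
    ring
  · exact neg_injective (eq_of_convexOn_PsiTilde (PsiTilde_neg L₁ L₂ ▸ h.neg))
end
end
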